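/- Let (λⱼ)_{j∈ℕ} be a nondecreasing sequence of nonnegative reals tending to infinity with Σⱼ e^{-tλⱼ} < ∞ for every t > 0, and suppose there are r > 0 and C > 0 with t^r · Σⱼ e^{-tλⱼ} → C as t → 0⁺. Let (aⱼ) be a bounded sequence of real numbers such that (Σⱼ aⱼ e^{-tλⱼ}) / (Σⱼ e^{-tλⱼ}) → a as t → 0⁺ for some real a. Then the Cesàro averages converge to the same limit: (1/N) Σ_{j<N} aⱼ → a as N → ∞. -/

import Mathlib

open Filter

open MeasureTheory ProbabilityTheory

lemma kar_moment (r : ℝ) (hr : 0 < r) (k : ℕ) :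
    ∫ s, (Real.exp (-|s|)) ^ k ∂(gammaMeasure r 1) = ((k : ℝ) + 1) ^ (-r) := by
  have hk : (0 : ℝ) < (k : ℝ) + 1 := by positivity
  rw [gammaMeasure, integral_withDensity_eq_integral_toReal_smul]
  · have h1 : ∀ s : ℝ, (gammaPDF r 1 s).toReal • (Real.exp (-|s|)) ^ k =
        Set.indicator (Set.Ici 0) (fun s => (1 / Real.Gamma r) *
          (s ^ (r - 1) * Real.exp (-(((k : ℝ) + 1) * s)))) s := by
      intro s
      rw [gammaPDF, ENNReal.toReal_ofReal (gammaPDFReal_nonneg hr one_pos s), gammaPDFReal]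
      by_cases hs : 0 ≤ s
      · rw [if_pos hs, Set.indicator_of_mem (by simpa using hs), abs_of_nonneg hs,
          ← Real.exp_nat_mul, Real.one_rpow, smul_eq_mul, mul_assoc, mul_assoc, ← Real.exp_add]
        congr 3
        ring_nf
      · rw [if_neg hs, Set.indicator_of_notMem (by simpa using hs), zero_smul]
    simp_rw [h1]
    rw [integral_indicator measurableSet_Ici, integral_Ici_eq_integral_Ioi, integral_const_mul,
      Real.integral_rpow_mul_exp_neg_mul_Ioi hr hk, Real.rpow_neg hk.le, one_div, one_div,
      Real.inv_rpow hk.le]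
    have := (Real.Gamma_pos_of_pos hr).ne'
    field_simp
  · exact (measurable_gammaPDFReal r 1).ennreal_ofReal
  · exact ae_of_all _ fun s => by simp [gammaPDF]

lemma kar_bump (r : ℝ) (hr : 0 < r) :
    Tendsto (fun n : ℕ => ∫ s, max 0 (1 - (n : ℝ) * |Real.exp (-|s|) - Real.exp (-1)|)
      ∂(gammaMeasure r 1)) atTop (nhds 0) := by
  have := isProbabilityMeasure_gammaMeasure hr one_pos
  suffices h0 : Tendsto (fun n : ℕ =>
      ∫ s, max 0 (1 - (n : ℝ) * |Real.exp (-|s|) - Real.exp (-1)|)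
      ∂(gammaMeasure r 1)) atTop (nhds (∫ s : ℝ, (0 : ℝ) ∂(gammaMeasure r 1))) by
    simpa using h0
  have hnull : gammaMeasure r 1 ({1, -1} : Set ℝ) = 0 := by
    unfold gammaMeasure
    exact withDensity_absolutelyContinuous _ _ ((Set.toFinite _).measure_zero _)
  apply tendsto_integral_of_dominated_convergence (fun _ => (1 : ℝ))
  · intro n
    exact Continuous.aestronglyMeasurable (by fun_prop)
  · exact integrable_const _
  · intro n
    refine ae_of_all _ fun s => ?_
    rw [Real.norm_eq_abs, abs_of_nonneg (le_max_left _ _)]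
    refine max_le zero_le_one ?_
    have : 0 ≤ (n : ℝ) * |Real.exp (-|s|) - Real.exp (-1)| := by positivity
    linarith
  · have : ∀ᵐ s ∂(gammaMeasure r 1), s ∉ ({1, -1} : Set ℝ) := by
      exact measure_eq_zero_iff_ae_notMem.1 hnull
    filter_upwards [this] with s hs
    have hd : 0 < |Real.exp (-|s|) - Real.exp (-1)| := by
      rw [abs_pos, sub_ne_zero]
      intro h
      have h2 : |s| = 1 := by
        have := Real.exp_injective h
        linarith
      rcases (abs_eq zero_le_one).1 h2 with h | h <;> simp [h] at hs
    apply tendsto_const_nhds.congr'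
    obtain ⟨n0, hn0⟩ := exists_nat_gt (1 / |Real.exp (-|s|) - Real.exp (-1)|)
    filter_upwards [eventually_ge_atTop n0] with n hn
    have hn' : (n0 : ℝ) ≤ n := by exact_mod_cast hn
    rw [div_lt_iff₀ hd] at hn0
    symm
    apply max_eq_left
    nlinarith

lemma kar_summable (lam : ℕ → ℝ) (hpos : ∀ j, 0 ≤ lam j)
    (hsum : ∀ t : ℝ, 0 < t → Summable (fun j => Real.exp (-(t * lam j))))
    (u : ℕ → ℝ) (K : ℝ) (hu : ∀ j, |u j| ≤ K) (φ : ℝ → ℝ) (B : ℝ)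
    (hφ : ∀ x ∈ Set.Icc (0 : ℝ) 1, |φ x| ≤ B) (t : ℝ) (ht : 0 < t) :
    Summable (fun j => u j * (Real.exp (-(t * lam j)) * φ (Real.exp (-(t * lam j))))) ∧
    |∑' j, u j * (Real.exp (-(t * lam j)) * φ (Real.exp (-(t * lam j))))| ≤
      K * B * ∑' j, Real.exp (-(t * lam j)) := by
  have hb : ∀ j, ‖u j * (Real.exp (-(t * lam j)) * φ (Real.exp (-(t * lam j))))‖ ≤
      K * B * Real.exp (-(t * lam j)) := by
    intro j
    have h1 : Real.exp (-(t * lam j)) ≤ 1 := by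
      rw [Real.exp_le_one_iff]; have := mul_nonneg ht.le (hpos j); linarith
    have h2 := hφ _ ⟨(Real.exp_pos (-(t * lam j))).le, h1⟩
    rw [Real.norm_eq_abs, abs_mul, abs_mul, abs_of_pos (Real.exp_pos _)]
    have hK : 0 ≤ K := (abs_nonneg _).trans (hu j)
    calc |u j| * (Real.exp (-(t * lam j)) * |φ (Real.exp (-(t * lam j)))|)
        ≤ K * (Real.exp (-(t * lam j)) * B) := by
          gcongr
          exact hu j
      _ = _ := by ring
  have hs := (hsum t ht).mul_left (K * B)
  refine ⟨Summable.of_norm_bounded hs hb, ?_⟩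
  have := tsum_of_norm_bounded hs.hasSum hb
  rwa [tsum_mul_left] at this

lemma kar_weier (lam : ℕ → ℝ) (hpos : ∀ j, 0 ≤ lam j)
    (hsum : ∀ t : ℝ, 0 < t → Summable (fun j => Real.exp (-(t * lam j))))
    (r C : ℝ) (hr : 0 < r) 
    (hheat : Tendsto (fun t : ℝ => t ^ r * ∑' j, Real.exp (-(t * lam j)))
      (nhdsWithin 0 (Set.Ioi 0)) (nhds C))
    (u : ℕ → ℝ) (K : ℝ) (hu : ∀ j, |u j| ≤ K) (c : ℝ)
    (hc : Tendsto (fun t : ℝ => t ^ r * ∑' j, u j * Real.exp (-(t * lam j)))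
      (nhdsWithin 0 (Set.Ioi 0)) (nhds c))
    (φ : ℝ → ℝ) (hφ : Continuous φ) :
    Tendsto (fun t : ℝ => t ^ r *
        ∑' j, u j * (Real.exp (-(t * lam j)) * φ (Real.exp (-(t * lam j)))))
      (nhdsWithin 0 (Set.Ioi 0)) (nhds (c * ∫ s, φ (Real.exp (-|s|)) ∂(gammaMeasure r 1))) := by
  have := isProbabilityMeasure_gammaMeasure hr one_pos
  have hbd : ∀ ψ : ℝ → ℝ, Continuous ψ → ∃ B, ∀ x ∈ Set.Icc (0 : ℝ) 1, |ψ x| ≤ B := by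
    intro ψ h
    obtain ⟨B, hB⟩ := isCompact_Icc.exists_bound_of_continuousOn (h.continuousOn (s := Set.Icc (0:ℝ) 1))
    exact ⟨B, hB⟩
  have hgm : ∀ s : ℝ, Real.exp (-|s|) ∈ Set.Icc (0 : ℝ) 1 := fun s =>
    ⟨(Real.exp_pos _).le, by rw [Real.exp_le_one_iff]; have := abs_nonneg s; linarith⟩
  have hint : ∀ ψ : ℝ → ℝ, Continuous ψ →
      Integrable (fun s => ψ (Real.exp (-|s|))) (gammaMeasure r 1) := by
    intro ψ h
    obtain ⟨B, hB⟩ := hbd ψ h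
    exact Integrable.of_bound (Continuous.aestronglyMeasurable (by fun_prop)) B
      (ae_of_all _ fun s => hB _ (hgm s))
  have hsm : ∀ ψ : ℝ → ℝ, Continuous ψ → ∀ t : ℝ, 0 < t →
      Summable (fun j => u j * (Real.exp (-(t * lam j)) * ψ (Real.exp (-(t * lam j))))) := by
    intro ψ h t ht
    obtain ⟨B, hB⟩ := hbd ψ h
    exact (kar_summable lam hpos hsum u K hu ψ B hB t ht).1
  -- polynomials
  have hpoly : ∀ p : Polynomial ℝ, Tendsto (fun t : ℝ => t ^ r *
        ∑' j, u j * (Real.exp (-(t * lam j)) * p.eval (Real.exp (-(t * lam j)))))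
      (nhdsWithin 0 (Set.Ioi 0))
      (nhds (c * ∫ s, p.eval (Real.exp (-|s|)) ∂(gammaMeasure r 1))) := by
    intro p
    induction p using Polynomial.induction_on' with
    | add p q hp hq =>
      have e1 : c * ∫ s, (p + q).eval (Real.exp (-|s|)) ∂(gammaMeasure r 1) =
          c * ∫ s, p.eval (Real.exp (-|s|)) ∂(gammaMeasure r 1) +
          c * ∫ s, q.eval (Real.exp (-|s|)) ∂(gammaMeasure r 1) := by
        simp_rw [Polynomial.eval_add]
        rw [integral_add (hint _ p.continuous) (hint _ q.continuous), mul_add]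
      rw [e1]
      refine (hp.add hq).congr' ?_
      filter_upwards [self_mem_nhdsWithin] with t ht
      rw [← mul_add, ← (hsm _ p.continuous t ht).tsum_add (hsm _ q.continuous t ht)]
      congr 2
      ext j
      rw [Polynomial.eval_add]; ring
    | monomial k b =>
      have hk : (0 : ℝ) < (k : ℝ) + 1 := by positivity
      simp_rw [Polynomial.eval_monomial]
      rw [integral_const_mul, kar_moment r hr k]
      have hsc : Tendsto (fun t : ℝ => ((k : ℝ) + 1) * t) (nhdsWithin 0 (Set.Ioi 0))
          (nhdsWithin 0 (Set.Ioi 0)) := by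
        apply tendsto_nhdsWithin_of_tendsto_nhds_of_eventually_within
        · have : Tendsto (fun t : ℝ => ((k : ℝ) + 1) * t) (nhds 0) (nhds (((k : ℝ) + 1) * 0)) :=
            (continuous_const.mul continuous_id).tendsto 0
          rw [mul_zero] at this
          exact this.mono_left nhdsWithin_le_nhds
        · filter_upwards [self_mem_nhdsWithin] with t ht
          exact mul_pos hk ht
      have h := (hc.comp hsc).const_mul (b * ((k : ℝ) + 1) ^ (-r))
      have e : c * (b * ((k : ℝ) + 1) ^ (-r)) = b * ((k : ℝ) + 1) ^ (-r) * c := by ring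
      rw [e]
      refine h.congr' ?_
      filter_upwards [self_mem_nhdsWithin] with t ht
      have ht' : (0 : ℝ) < t := ht
      have e2 : ∀ j, u j * (Real.exp (-(t * lam j)) * (b * Real.exp (-(t * lam j)) ^ k)) =
          b * (u j * Real.exp (-(((k : ℝ) + 1) * t * lam j))) := by
        intro j
        have : Real.exp (-(((k : ℝ) + 1) * t * lam j)) =
            Real.exp (-(t * lam j)) * Real.exp (-(t * lam j)) ^ k := by
          rw [← Real.exp_nat_mul, ← Real.exp_add]; congr 1; ring
        rw [this]; ring
      simp_rw [e2]
      rw [tsum_mul_left]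
      simp only [Function.comp]
      rw [Real.mul_rpow hk.le ht'.le, Real.rpow_neg hk.le]
      have := (Real.rpow_pos_of_pos hk r).ne'
      field_simp
  -- approximation
  rw [Metric.tendsto_nhds]
  intro ε hε
  have hK : 0 ≤ K := (abs_nonneg _).trans (hu 0)
  set D : ℝ := K * (|C| + 1) + |c| + 1 with hD
  have hDpos : 0 < D := by positivity
  obtain ⟨p, hp⟩ := exists_polynomial_near_of_continuousOn 0 1 φ hφ.continuousOn (ε / (2 * D))
    (by positivity)
  set δ := ε / (2 * D) with hδ
  have hδpos : 0 < δ := by positivity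
  have hp1 := (Metric.tendsto_nhds.1 (hpoly p)) (ε / 2) (by positivity)
  have hZ : ∀ᶠ t : ℝ in nhdsWithin 0 (Set.Ioi 0),
      t ^ r * ∑' j, Real.exp (-(t * lam j)) < |C| + 1 :=
    hheat.eventually_lt_const (by have := le_abs_self C; linarith)
  filter_upwards [hp1, hZ, self_mem_nhdsWithin] with t h1 h2 ht
  have ht' : (0 : ℝ) < t := ht
  have htr : 0 < t ^ r := Real.rpow_pos_of_pos ht' r
  rw [Real.dist_eq] at h1 ⊢
  have hdiff : |t ^ r * ∑' j, u j * (Real.exp (-(t * lam j)) * φ (Real.exp (-(t * lam j)))) -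
      t ^ r * ∑' j, u j * (Real.exp (-(t * lam j)) * p.eval (Real.exp (-(t * lam j))))| ≤
      K * δ * (|C| + 1) := by
    rw [← mul_sub, ← (hsm _ hφ t ht').tsum_sub (hsm _ p.continuous t ht')]
    have h3 := (kar_summable lam hpos hsum u K hu (fun x => φ x - p.eval x) δ
      (fun x hx => by rw [abs_sub_comm]; exact (hp x hx).le) t ht').2
    have e3 : ∀ j, u j * (Real.exp (-(t * lam j)) * φ (Real.exp (-(t * lam j)))) -
        u j * (Real.exp (-(t * lam j)) * p.eval (Real.exp (-(t * lam j)))) =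
        u j * (Real.exp (-(t * lam j)) *
          (φ (Real.exp (-(t * lam j))) - p.eval (Real.exp (-(t * lam j))))) := by
      intro j; ring
    simp_rw [e3]
    rw [abs_mul, abs_of_pos htr]
    calc _ ≤ t ^ r * (K * δ * ∑' j, Real.exp (-(t * lam j))) := by gcongr
      _ = K * δ * (t ^ r * ∑' j, Real.exp (-(t * lam j))) := by ring
      _ ≤ _ := by gcongr
  have hI : |∫ s, p.eval (Real.exp (-|s|)) ∂(gammaMeasure r 1) -
      ∫ s, φ (Real.exp (-|s|)) ∂(gammaMeasure r 1)| ≤ δ := by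
    rw [← integral_sub (hint _ p.continuous) (hint _ hφ)]
    have := norm_integral_le_of_norm_le_const (μ := gammaMeasure r 1)
      (f := fun s => p.eval (Real.exp (-|s|)) - φ (Real.exp (-|s|))) (C := δ)
      (ae_of_all _ fun s => (hp _ (hgm s)).le)
    simpa using this
  have hI2 : |c * ∫ s, p.eval (Real.exp (-|s|)) ∂(gammaMeasure r 1) -
      c * ∫ s, φ (Real.exp (-|s|)) ∂(gammaMeasure r 1)| ≤ |c| * δ := by
    rw [← mul_sub, abs_mul]; gcongr
  have hfin : K * δ * (|C| + 1) + |c| * δ < ε / 2 := by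
    have : δ * D = ε / 2 := by rw [hδ]; field_simp
    nlinarith
  rw [abs_lt] at h1 ⊢
  rw [abs_le] at hdiff hI2
  constructor <;> linarith [h1.1, h1.2, hdiff.1, hdiff.2, hI2.1, hI2.2]

lemma kar_growth (lam : ℕ → ℝ) (hmono : Monotone lam) (hpos : ∀ j, 0 ≤ lam j)
    (htop : Tendsto lam atTop atTop)
    (hsum : ∀ t : ℝ, 0 < t → Summable (fun j => Real.exp (-(t * lam j))))
    (r C : ℝ) (hr : 0 < r) (hC : 0 < C)
    (hheat : Tendsto (fun t : ℝ => t ^ r * ∑' j, Real.exp (-(t * lam j)))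
      (nhdsWithin 0 (Set.Ioi 0)) (nhds C)) :
    ∃ D : ℝ, 0 < D ∧ ∀ᶠ N : ℕ in atTop, lam N ^ r ≤ D * N := by
  have h2r : (0 : ℝ) < 2 ^ r := by positivity
  obtain ⟨s, hs0, hs⟩ : ∃ s : ℝ, 0 < s ∧ Real.exp (-(s / 2)) * 2 ^ r * 2 ≤ 1 / 4 := by
    have h : Tendsto (fun s : ℝ => Real.exp (-(s / 2)) * 2 ^ r * 2) atTop (nhds 0) := by
      have h1 : Tendsto (fun s : ℝ => Real.exp (-(s / 2))) atTop (nhds 0) :=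
        Real.tendsto_exp_neg_atTop_nhds_zero.comp (tendsto_id.atTop_div_const two_pos)
      simpa using (h1.mul_const (2 ^ r)).mul_const 2
    obtain ⟨s, h3, h4⟩ := ((h.eventually_le_const (by norm_num : (0 : ℝ) < 1 / 4)).and
      (eventually_gt_atTop 0)).exists
    exact ⟨s, h4, h3⟩
  have hsr : 0 < s ^ r := Real.rpow_pos_of_pos hs0 r
  refine ⟨s ^ r * (2 / C), by positivity, ?_⟩
  have hT : ∀ q : ℝ, 0 < q → Tendsto (fun N => q / lam N) atTop (nhdsWithin 0 (Set.Ioi 0)) := by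
    intro q hq
    apply tendsto_nhdsWithin_of_tendsto_nhds_of_eventually_within
    · exact htop.const_div_atTop q
    · filter_upwards [htop.eventually_gt_atTop 0] with N hN
      exact div_pos hq hN
  have e1 := (hT s hs0).eventually
    (hheat.eventually_const_lt (by linarith : 3 * C / 4 < C))
  have e2 := (hT (s / 2) (by positivity)).eventually
    (hheat.eventually_lt_const (by linarith : C < 2 * C))
  filter_upwards [e1, e2, htop.eventually_gt_atTop 0] with N h1 h2 hN
  set t := s / lam N with ht
  have htpos : 0 < t := div_pos hs0 hN
  have et : s / 2 / lam N = t / 2 := by rw [ht]; ring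
  rw [et] at h2
  have hsplit := (hsum t htpos).sum_add_tsum_nat_add N
  have ha : ∑ i ∈ Finset.range N, Real.exp (-(t * lam i)) ≤ N := by
    calc _ ≤ ∑ i ∈ Finset.range N, (1 : ℝ) := by
          apply Finset.sum_le_sum
          intro i _
          rw [Real.exp_le_one_iff]; have := mul_nonneg htpos.le (hpos i); linarith
      _ = N := by simp
  have hs2 := hsum (t / 2) (by positivity)
  have hb : ∑' i, Real.exp (-(t * lam (i + N))) ≤
      Real.exp (-(s / 2)) * ∑' i, Real.exp (-(t / 2 * lam i)) := by
    calc _ ≤ ∑' i, Real.exp (-(s / 2)) * Real.exp (-(t / 2 * lam (i + N))) := by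
          apply Summable.tsum_le_tsum
          · intro i
            rw [← Real.exp_add, Real.exp_le_exp]
            have h3 : lam N ≤ lam (i + N) := hmono (by omega)
            have h4 : t * lam N = s := by rw [ht]; field_simp
            nlinarith [mul_le_mul_of_nonneg_left h3 htpos.le]
          · exact (summable_nat_add_iff N).2 (hsum t htpos)
          · exact ((summable_nat_add_iff N).2 hs2).mul_left _
      _ = Real.exp (-(s / 2)) * ∑' i, Real.exp (-(t / 2 * lam (i + N))) := tsum_mul_left
      _ ≤ _ := by
          refine mul_le_mul_of_nonneg_left ?_ (Real.exp_pos _).le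
          rw [← hs2.sum_add_tsum_nat_add N]
          have : 0 ≤ ∑ i ∈ Finset.range N, Real.exp (-(t / 2 * lam i)) :=
            Finset.sum_nonneg fun i _ => (Real.exp_pos _).le
          linarith
  have htr : 0 < t ^ r := Real.rpow_pos_of_pos htpos r
  have ed : t ^ r = 2 ^ r * (t / 2) ^ r := by
    rw [← Real.mul_rpow (by norm_num) (by positivity)]; congr 1; ring
  have hc : t ^ r * (Real.exp (-(s / 2)) * ∑' i, Real.exp (-(t / 2 * lam i))) ≤ C / 4 := by
    calc _ = Real.exp (-(s / 2)) * 2 ^ r *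
          ((t / 2) ^ r * ∑' i, Real.exp (-(t / 2 * lam i))) := by rw [ed]; ring
      _ ≤ Real.exp (-(s / 2)) * 2 ^ r * (2 * C) := by gcongr
      _ = (Real.exp (-(s / 2)) * 2 ^ r * 2) * C := by ring
      _ ≤ 1 / 4 * C := by gcongr
      _ = C / 4 := by ring
  have hd : C / 2 ≤ t ^ r * N := by
    have h5 : t ^ r * ∑' j, Real.exp (-(t * lam j)) ≤
        t ^ r * (N + Real.exp (-(s / 2)) * ∑' i, Real.exp (-(t / 2 * lam i))) := by
      gcongr; linarith
    rw [mul_add] at h5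
    linarith
  have hl : t ^ r * lam N ^ r = s ^ r := by
    rw [← Real.mul_rpow htpos.le hN.le]; congr 1; rw [ht]; field_simp
  rw [← hl]
  have hlr : 0 < lam N ^ r := Real.rpow_pos_of_pos hN r
  calc lam N ^ r = lam N ^ r * (2 / C) * (C / 2) := by field_simp
    _ ≤ lam N ^ r * (2 / C) * (t ^ r * N) := by gcongr
    _ = _ := by ring

lemma kar_cut (lam : ℕ → ℝ) (hmono : Monotone lam) (hpos : ∀ j, 0 ≤ lam j)
    (hsum : ∀ t : ℝ, 0 < t → Summable (fun j => Real.exp (-(t * lam j))))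
    (b : ℕ → ℝ) (K : ℝ) (hb : ∀ j, |b j| ≤ K) (n N : ℕ) (t : ℝ) (ht : 0 < t)
    (htN : t * lam N = 1) (h ψ : ℝ → ℝ)
    (hh : h = fun x => (max x (Real.exp (-1)))⁻¹ *
      max 0 (min 1 (1 - (n : ℝ) * (Real.exp (-1) - x))))
    (hψ : ψ = fun x => max 0 (1 - (n : ℝ) * |x - Real.exp (-1)|)) :
    |∑ j ∈ Finset.range N, b j| ≤
      |∑' j, b j * (Real.exp (-(t * lam j)) * h (Real.exp (-(t * lam j))))| +
      K * Real.exp 1 * ∑' j, 1 * (Real.exp (-(t * lam j)) * ψ (Real.exp (-(t * lam j)))) := by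
  have hK : 0 ≤ K := (abs_nonneg _).trans (hb 0)
  have he : 0 < Real.exp (-1) := Real.exp_pos _
  have hn : (0 : ℝ) ≤ n := by positivity
  have hψ0 : ∀ x, 0 ≤ ψ x := by intro x; rw [hψ]; exact le_max_left _ _
  have hψ1 : ∀ x, ψ x ≤ 1 := by
    intro x; rw [hψ]
    refine max_le zero_le_one ?_
    have : 0 ≤ (n : ℝ) * |x - Real.exp (-1)| := by positivity
    linarith
  have hh1 : ∀ x, |h x| ≤ Real.exp 1 := by
    intro x
    rw [hh]
    simp only
    have h1 : 0 ≤ max 0 (min 1 (1 - (n : ℝ) * (Real.exp (-1) - x))) := le_max_left _ _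
    have h2 : max 0 (min 1 (1 - (n : ℝ) * (Real.exp (-1) - x))) ≤ 1 :=
      max_le zero_le_one (min_le_left _ _)
    have h3 : (max x (Real.exp (-1)))⁻¹ ≤ Real.exp 1 := by
      have : Real.exp 1 = (Real.exp (-1))⁻¹ := by rw [← Real.exp_neg, neg_neg]
      rw [this]
      exact inv_anti₀ he (le_max_right _ _)
    have h4 : 0 < max x (Real.exp (-1)) := lt_max_of_lt_right he
    rw [abs_mul, abs_of_nonneg h1, abs_of_nonneg (by positivity)]
    calc _ ≤ Real.exp 1 * 1 := by gcongr
      _ = _ := mul_one _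
  have hS := (kar_summable lam hpos hsum b K hb h (Real.exp 1) (fun x _ => hh1 x) t ht).1
  have hP := (kar_summable lam hpos hsum (fun _ => 1) 1 (by simp) ψ 1
    (fun x _ => by rw [abs_of_nonneg (hψ0 x)]; exact hψ1 x) t ht).1
  have hA : ∑ j ∈ Finset.range N,
      b j * (Real.exp (-(t * lam j)) * h (Real.exp (-(t * lam j)))) =
      ∑ j ∈ Finset.range N, b j := by
    apply Finset.sum_congr rfl
    intro j hj
    have hj' : lam j ≤ lam N := hmono (Finset.mem_range.1 hj).le
    have hx : Real.exp (-1) ≤ Real.exp (-(t * lam j)) := by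
      rw [Real.exp_le_exp]
      nlinarith [mul_le_mul_of_nonneg_left hj' ht.le]
    generalize Real.exp (-(t * lam j)) = x at hx
    have hx0 : 0 < x := lt_of_lt_of_le he hx
    rw [hh]
    simp only
    rw [max_eq_left hx, min_eq_left (by nlinarith), max_eq_right zero_le_one]
    field_simp
  have hB : |∑' i, b (i + N) * (Real.exp (-(t * lam (i + N))) *
      h (Real.exp (-(t * lam (i + N)))))| ≤
      ∑' i, K * Real.exp 1 * (1 * (Real.exp (-(t * lam (i + N))) *
        ψ (Real.exp (-(t * lam (i + N)))))) := by
    rw [← Real.norm_eq_abs]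
    refine tsum_of_norm_bounded
      (((summable_nat_add_iff N).2 hP).mul_left (K * Real.exp 1)).hasSum ?_
    intro i
    have hj' : lam N ≤ lam (i + N) := hmono (by omega)
    have hx : Real.exp (-(t * lam (i + N))) ≤ Real.exp (-1) := by
      rw [Real.exp_le_exp]
      nlinarith [mul_le_mul_of_nonneg_left hj' ht.le]
    have hx0 := Real.exp_pos (-(t * lam (i + N)))
    have hbi := hb (i + N)
    generalize Real.exp (-(t * lam (i + N))) = x at hx hx0
    have e1 : h x = Real.exp 1 * ψ x := by
      rw [hh, hψ]
      simp only
      rw [max_eq_right hx, min_eq_right (by nlinarith), ← Real.exp_neg, neg_neg,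
        abs_of_nonpos (by linarith)]
      ring_nf
    have h5 := hψ0 x
    rw [e1, Real.norm_eq_abs, abs_mul,
      abs_of_nonneg (a := x * (Real.exp 1 * ψ x)) (by positivity)]
    calc _ ≤ K * (x * (Real.exp 1 * ψ x)) := by gcongr
      _ = _ := by ring
  rw [tsum_mul_left] at hB
  have hB2 : ∑' i, 1 * (Real.exp (-(t * lam (i + N))) * ψ (Real.exp (-(t * lam (i + N))))) ≤
      ∑' j, 1 * (Real.exp (-(t * lam j)) * ψ (Real.exp (-(t * lam j)))) := by
    rw [← hP.sum_add_tsum_nat_add N]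
    have : 0 ≤ ∑ i ∈ Finset.range N,
        1 * (Real.exp (-(t * lam i)) * ψ (Real.exp (-(t * lam i)))) :=
      Finset.sum_nonneg fun i _ => by have := hψ0 (Real.exp (-(t * lam i))); positivity
    linarith
  have hB3 := mul_le_mul_of_nonneg_left hB2 (by positivity : 0 ≤ K * Real.exp 1)
  have hsp := hS.sum_add_tsum_nat_add N
  rw [hA] at hsp
  rw [← hsp]
  have := abs_sub_abs_le_abs_sub (∑ j ∈ Finset.range N, b j)
    (-∑' i, b (i + N) * (Real.exp (-(t * lam (i + N))) * h (Real.exp (-(t * lam (i + N))))))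
  rw [abs_neg, sub_neg_eq_add] at this
  linarith

/-- Discrete form of Karamata's Tauberian theorem: if the heat-trace-weighted averages
of a bounded sequence `a` converge to `A` as `t → 0⁺`, then the Cesàro averages of `a`
converge to `A`. -/
theorem karamata_discrete_cesaro
    (lam : ℕ → ℝ) (hmono : Monotone lam) (hpos : ∀ j, 0 ≤ lam j)
    (htop : Tendsto lam atTop atTop)
    (hsum : ∀ t : ℝ, 0 < t → Summable (fun j => Real.exp (-(t * lam j))))
    (r C : ℝ) (hr : 0 < r) (hC : 0 < C)
    (hheat : Tendsto (fun t : ℝ => t ^ r * ∑' j, Real.exp (-(t * lam j)))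
      (nhdsWithin 0 (Set.Ioi 0)) (nhds C))
    (a : ℕ → ℝ) (M : ℝ) (hbnd : ∀ j, |a j| ≤ M) (A : ℝ)
    (havg : Tendsto
      (fun t : ℝ => (∑' j, a j * Real.exp (-(t * lam j))) / ∑' j, Real.exp (-(t * lam j)))
      (nhdsWithin 0 (Set.Ioi 0)) (nhds A)) :
    Tendsto (fun N : ℕ => (∑ j ∈ Finset.range N, a j) / (N : ℝ)) atTop (nhds A) := by
  set b : ℕ → ℝ := fun j => a j - A with hbdef
  set K : ℝ := M + |A| with hKdef
  have hb : ∀ j, |b j| ≤ K := fun j => (abs_sub _ _).trans (by have := hbnd j; linarith)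
  have hK : 0 ≤ K := (abs_nonneg _).trans (hb 0)
  have hbase : Tendsto (fun t : ℝ => t ^ r * ∑' j, b j * Real.exp (-(t * lam j)))
      (nhdsWithin 0 (Set.Ioi 0)) (nhds 0) := by
    have h1 := hheat.mul (havg.sub_const A)
    rw [sub_self, mul_zero] at h1
    refine h1.congr' ?_
    filter_upwards [self_mem_nhdsWithin] with t ht
    have hZ := hsum t ht
    have hZpos : 0 < ∑' j, Real.exp (-(t * lam j)) :=
      hZ.tsum_pos (fun j => (Real.exp_pos _).le) 0 (Real.exp_pos _)
    have hSa : Summable (fun j => a j * Real.exp (-(t * lam j))) := by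
      simpa using (kar_summable lam hpos hsum a M hbnd (fun _ => 1) 1 (by simp) t ht).1
    have e : ∑' j, b j * Real.exp (-(t * lam j)) =
        ∑' j, a j * Real.exp (-(t * lam j)) - A * ∑' j, Real.exp (-(t * lam j)) := by
      rw [← tsum_mul_left, ← hSa.tsum_sub (hZ.mul_left A)]
      simp_rw [hbdef, sub_mul]
    rw [e]
    field_simp
  obtain ⟨D, hD, hgrow⟩ := kar_growth lam hmono hpos htop hsum r C hr hC hheat
  suffices hmain : Tendsto (fun N : ℕ => (∑ j ∈ Finset.range N, b j) / (N : ℝ)) atTop (nhds 0) by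
    have h2 := hmain.add_const A
    rw [zero_add] at h2
    refine h2.congr' ?_
    filter_upwards [eventually_gt_atTop 0] with N hN
    have hN' : (N : ℝ) ≠ 0 := by positivity
    simp only [hbdef, Finset.sum_sub_distrib, Finset.sum_const, Finset.card_range, nsmul_eq_mul]
    field_simp
    ring
  rw [Metric.tendsto_nhds]
  intro ε hε
  set η : ℝ := ε / (2 * D) with hη
  have hηpos : 0 < η := by positivity
  set L : ℝ := K * Real.exp 1 with hL
  have hLn : 0 ≤ L := by positivity
  -- choose the width of the bump
  have hbump := (kar_bump r hr).const_mul (L * C)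
  rw [mul_zero] at hbump
  obtain ⟨n, hn⟩ := (hbump.eventually_lt_const hηpos).exists
  set h : ℝ → ℝ := fun x => (max x (Real.exp (-1)))⁻¹ *
      max 0 (min 1 (1 - (n : ℝ) * (Real.exp (-1) - x))) with hh
  set ψ : ℝ → ℝ := fun x => max 0 (1 - (n : ℝ) * |x - Real.exp (-1)|) with hψ
  have hhc : Continuous h := by
    apply Continuous.mul
    · apply Continuous.inv₀ (by fun_prop)
      intro x
      exact (lt_max_of_lt_right (Real.exp_pos _)).ne'
    · fun_prop
  have hψc : Continuous ψ := by fun_prop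
  have t1 := kar_weier lam hpos hsum r C hr hheat b K hb 0 hbase h hhc
  have t2 := (kar_weier lam hpos hsum r C hr hheat (fun _ => 1) 1 (by simp) C
    (by simpa using hheat) ψ hψc).const_mul L
  rw [zero_mul] at t1
  have hT : Tendsto (fun N => 1 / lam N) atTop (nhdsWithin 0 (Set.Ioi 0)) := by
    apply tendsto_nhdsWithin_of_tendsto_nhds_of_eventually_within
    · exact htop.const_div_atTop 1
    · filter_upwards [htop.eventually_gt_atTop 0] with N hN
      exact div_pos one_pos hN
  have e1 := hT.eventually ((Metric.tendsto_nhds.1 t1) η hηpos)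
  have e2 := hT.eventually (t2.eventually_lt_const (by rw [← mul_assoc]; exact hn))
  filter_upwards [e1, e2, hgrow, htop.eventually_gt_atTop 0, eventually_gt_atTop 0]
    with N h1 h2 h3 hN hN0
  have hNpos : (0 : ℝ) < N := by exact_mod_cast hN0
  set t := 1 / lam N with ht
  have htpos : 0 < t := div_pos one_pos hN
  have htN : t * lam N = 1 := by rw [ht]; field_simp
  have hcut := kar_cut lam hmono hpos hsum b K hb n N t htpos htN h ψ hh hψ
  have htr : 0 < t ^ r := Real.rpow_pos_of_pos htpos r
  rw [Real.dist_eq, sub_zero, abs_mul, abs_of_pos htr] at h1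
  have h4 : t ^ r * |∑ j ∈ Finset.range N, b j| < 2 * η := by
    have := mul_le_mul_of_nonneg_left hcut htr.le
    rw [mul_add] at this
    have e5 : ∀ S : ℝ, t ^ r * (K * Real.exp 1 * S) = L * (t ^ r * S) := by
      intro S; rw [hL]; ring
    rw [e5] at this
    linarith
  have hl : t ^ r * lam N ^ r = 1 := by
    rw [← Real.mul_rpow htpos.le hN.le, htN, Real.one_rpow]
  have hlr : 0 < lam N ^ r := Real.rpow_pos_of_pos hN r
  rw [Real.dist_eq, sub_zero, abs_div, abs_of_pos hNpos, div_lt_iff₀ hNpos]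
  calc |∑ j ∈ Finset.range N, b j|
      = lam N ^ r * (t ^ r * |∑ j ∈ Finset.range N, b j|) := by
        rw [← mul_assoc, mul_comm (lam N ^ r), hl, one_mul]
    _ < lam N ^ r * (2 * η) := by gcongr
    _ ≤ D * N * (2 * η) := by gcongr
    _ = ε * N := by rw [hη]; field_simp
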